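/- For every even integer n ≥ 8, every simple graph F on n vertices satisfying F → (P_3, C_n) has at least (3/2)n + 2 edges, and there exists a simple graph F on n vertices with at most 2n − 1 edges satisfying F → (P_3, C_n); consequently (3/2)n + 2 ≤ r*(P_3, C_n) ≤ 2n − 1. -/

import Mathlib

open SimpleGraph

/-- `F` contains a copy of `G` (an injective graph homomorphism from `G` to `F`). -/
def Contains {α β : Type*} (F : SimpleGraph α) (G : SimpleGraph β) : Prop :=
  ∃ f : G →g F, Function.Injective f

/-- `F → (G, H)`: for every red/blue coloring of the edges of `F` (given by the spanning
subgraph `R ≤ F` of red edges, the other edges of `F` being blue), there is a red copy of `G`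
or a blue copy of `H`. -/
def Arrows {α β γ : Type*} (F : SimpleGraph α) (G : SimpleGraph β) (H : SimpleGraph γ) : Prop :=
  ∀ R : SimpleGraph α, R ≤ F → Contains R G ∨ Contains (F \ R) H

namespace RSR

/-- consecutive pairs of a vertex list, each pair ordered -/
def edgesOf : List ℕ → List (ℕ × ℕ)
  | a :: b :: l => (min a b, max a b) :: edgesOf (b :: l)
  | _ => []

/-- For every matching among the edges `E`, some member of `H` avoids it. -/
def check : ℕ → List (ℕ × ℕ) → List (List (ℕ × ℕ)) → Bool
  | 0, _, _ => false
  | _ + 1, [], H => !H.isEmpty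
  | k + 1, e :: E, H => check k E H &&
      check k (E.filter fun f => f.1 != e.1 && f.1 != e.2 && f.2 != e.1 && f.2 != e.2)
        (H.filter fun h => !h.contains e && !h.contains (e.2, e.1))

/-- symmetric relation given by a matching -/
structure Mat (r : ℕ → ℕ → Prop) : Prop where
  symm : ∀ a b, r a b → r b a
  uniq : ∀ a b c, r a b → r a c → b = c

theorem check_sound {r : ℕ → ℕ → Prop} (hr : Mat r) :
    ∀ (k : ℕ) (E : List (ℕ × ℕ)) (H : List (List (ℕ × ℕ))), check k E H = true →
      (∀ h ∈ H, ∀ e ∈ h, e ∈ E ∨ ¬ r e.1 e.2) → ∃ h ∈ H, ∀ e ∈ h, ¬ r e.1 e.2 := by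
  intro k
  induction k with
  | zero => intro E H h; simp [check] at h
  | succ k ih =>
    intro E H h hI
    cases E with
    | nil =>
      cases H with
      | nil => simp [check] at h
      | cons h0 H =>
        refine ⟨h0, by simp, fun e he => ?_⟩
        rcases hI h0 (by simp) e he with h1 | h1
        · simp at h1
        · exact h1
    | cons e E =>
      simp only [check, Bool.and_eq_true] at h
      by_cases hre : r e.1 e.2
      · obtain ⟨h0, hh0, h0r⟩ := ih _ _ h.2 (by
          intro h0 hh0 f hf
          simp only [List.mem_filter, Bool.and_eq_true, Bool.not_eq_true',
            bne_iff_ne] at hh0 ⊢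
          obtain ⟨hH, hn1, hn2⟩ := hh0
          have hfe : f ≠ e := by
            rintro rfl
            rw [List.contains_iff_mem.2 hf] at hn1; cases hn1
          have hfe2 : f ≠ (e.2, e.1) := by
            rintro rfl
            rw [List.contains_iff_mem.2 hf] at hn2; cases hn2
          by_cases hrf : r f.1 f.2
          · left
            rcases hI h0 hH f hf with h1 | h1
            · rcases List.mem_cons.1 h1 with h1 | h1
              · exact absurd h1 hfe
              · refine ⟨h1, ⟨⟨?_, ?_⟩, ?_⟩, ?_⟩
                · intro h; exact hfe (Prod.ext h (hr.uniq _ _ _ (h ▸ hrf) hre))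
                · intro h; exact hfe2 (Prod.ext h (hr.uniq _ _ _ (h ▸ hrf) (hr.symm _ _ hre)))
                · intro h
                  exact hfe2 (Prod.ext (hr.uniq _ _ _ (h ▸ hr.symm _ _ hrf) hre) h)
                · intro h
                  exact hfe (Prod.ext (hr.uniq _ _ _ (h ▸ hr.symm _ _ hrf) (hr.symm _ _ hre)) h)
            · exact absurd hrf h1
          · exact Or.inr hrf)
        exact ⟨h0, (List.mem_filter.1 hh0).1, h0r⟩
      · refine ih _ _ h.1 ?_
        intro h0 hh0 f hf
        rcases hI h0 hh0 f hf with h1 | h1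
        · rcases List.mem_cons.1 h1 with rfl | h1
          · exact Or.inr hre
          · exact Or.inl h1
        · exact Or.inr h1

/-- adjacency in the edge list, avoiding `r` -/
def Sadj (E : List (ℕ × ℕ)) (r : ℕ → ℕ → Prop) (a b : ℕ) : Prop :=
  ((a, b) ∈ E ∨ (b, a) ∈ E) ∧ ¬ r a b

theorem Sadj.symm {E r} (hr : Mat r) {a b : ℕ} (h : Sadj E r a b) : Sadj E r b a :=
  ⟨h.1.symm, fun h' => h.2 (hr.symm _ _ h')⟩

theorem Sadj.mono {E E' r} (hE : ∀ e ∈ E, e ∈ E') {a b : ℕ} (h : Sadj E r a b) : Sadj E' r a b :=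
  ⟨h.1.imp (hE _) (hE _), h.2⟩

theorem chain_of_edges {E : List (ℕ × ℕ)} {r : ℕ → ℕ → Prop} (hr : Mat r) :
    ∀ l : List ℕ, (∀ e ∈ edgesOf l, e ∈ E ∧ ¬ r e.1 e.2) → List.IsChain (Sadj E r) l
  | [], _ => by simp
  | [a], _ => by simp
  | a :: b :: l, h => by
    rw [List.isChain_cons_cons]
    refine ⟨?_, chain_of_edges hr (b :: l) fun e he => h e (by simp [edgesOf, he])⟩
    have := h (min a b, max a b) (by simp [edgesOf])
    rcases le_total a b with hab | hab
    · simp only [min_eq_left hab, max_eq_right hab] at this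
      exact ⟨Or.inl this.1, this.2⟩
    · simp only [min_eq_right hab, max_eq_left hab] at this
      exact ⟨Or.inr this.1, fun h' => this.2 (hr.symm _ _ h')⟩

theorem check_paths {r : ℕ → ℕ → Prop} (hr : Mat r) (k : ℕ) (E : List (ℕ × ℕ))
    (s t : ℕ) (H : List (List ℕ))
    (h1 : check k E (H.map fun q => edgesOf (s :: (q ++ [t]))) = true)
    (h2 : ∀ q ∈ H, ∀ e ∈ edgesOf (s :: (q ++ [t])), e ∈ E) :
    ∃ q ∈ H, List.IsChain (Sadj E r) (s :: (q ++ [t])) := by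
  obtain ⟨h, hh, hhr⟩ := check_sound hr k E _ h1 (by
    intro h hh e he
    obtain ⟨q, hq, rfl⟩ := List.mem_map.1 hh
    exact Or.inl (h2 q hq e he))
  obtain ⟨q, hq, rfl⟩ := List.mem_map.1 hh
  exact ⟨q, hq, chain_of_edges hr _ fun e he => ⟨h2 q hq e he, hhr e he⟩⟩

def E7 : List (ℕ × ℕ) := [(0, 1), (0, 3), (0, 5), (0, 6), (1, 2), (1, 4), (2, 3), (2, 5), (3, 4),
  (4, 5), (4, 6)]
def H7 : List (List ℕ) := [[0, 1, 2, 3, 4], [0, 3, 2, 1, 4], [2, 1, 0, 3, 4], [2, 1, 4, 3, 0],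
  [2, 3, 0, 1, 4], [2, 3, 4, 1, 0], [4, 1, 2, 3, 0], [4, 3, 2, 1, 0]]
def E5 : List (ℕ × ℕ) := [(0, 2), (0, 3), (0, 4), (1, 2), (1, 3), (2, 3), (2, 4), (3, 4)]
def H5 : List (List ℕ) := [[3, 4, 2], [2, 4, 3], [3, 2, 4], [2, 3, 4]]
def E8 : List (ℕ × ℕ) := [(0, 4), (0, 5), (0, 6), (0, 7), (1, 4), (1, 5), (1, 6), (1, 7), (2, 4),
  (2, 5), (2, 6), (2, 7), (3, 4), (3, 5), (3, 6)]
def H8 : List (List ℕ) := [[4, 2, 7, 1, 5, 3, 6], [4, 2, 7, 1, 6, 3, 5], [5, 1, 4, 3, 6, 2, 7],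
  [5, 1, 7, 2, 4, 3, 6], [5, 2, 4, 3, 6, 1, 7], [5, 2, 7, 1, 4, 3, 6], [5, 3, 4, 1, 6, 2, 7],
  [5, 3, 4, 1, 7, 2, 6], [5, 3, 4, 2, 7, 1, 6], [5, 3, 6, 1, 4, 2, 7], [5, 3, 6, 2, 4, 1, 7],
  [6, 1, 4, 3, 5, 2, 7], [6, 2, 4, 3, 5, 1, 7], [6, 2, 5, 3, 4, 1, 7], [6, 3, 4, 1, 5, 2, 7],
  [6, 3, 4, 2, 5, 1, 7], [6, 3, 5, 1, 4, 2, 7], [6, 3, 5, 2, 4, 1, 7]]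

set_option maxRecDepth 100000 in
theorem ham7 {r : ℕ → ℕ → Prop} (hr : Mat r) :
    ∃ q : List ℕ, q.Perm (List.range 5) ∧ List.IsChain (Sadj E7 r) (5 :: (q ++ [6])) := by
  obtain ⟨q, hq, hc⟩ := check_paths hr 12 E7 5 6 H7 (by decide +kernel) (by decide +kernel)
  have : ∀ q ∈ H7, q.Perm (List.range 5) := by decide +kernel
  exact ⟨q, this q hq, hc⟩

set_option maxRecDepth 100000 in
theorem ham5 {r : ℕ → ℕ → Prop} (hr : Mat r) :
    ∃ q : List ℕ, q.Perm [2, 3, 4] ∧ List.IsChain (Sadj E5 r) (1 :: (q ++ [0])) := by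
  obtain ⟨q, hq, hc⟩ := check_paths hr 9 E5 1 0 H5 (by decide +kernel) (by decide +kernel)
  have : ∀ q ∈ H5, q.Perm [2, 3, 4] := by decide +kernel
  exact ⟨q, this q hq, hc⟩

set_option maxRecDepth 100000 in
theorem ham8 {r : ℕ → ℕ → Prop} (hr : Mat r) :
    ∃ q : List ℕ, (0 :: q).Perm (List.range 8) ∧
      List.IsChain (Sadj E8 r) (0 :: (q ++ [0])) := by
  obtain ⟨q, hq, hc⟩ := check_paths hr 16 E8 0 0 H8 (by decide +kernel) (by decide +kernel)
  have : ∀ q ∈ H8, (0 :: q).Perm (List.range 8) := by decide +kernel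
  exact ⟨q, this q hq, hc⟩

/-- the chain of layers ending in the cap `E7` -/
def capE : ℕ → List (ℕ × ℕ)
  | 0 => E7
  | t + 1 => (2 * t + 5, 2 * t + 7) :: (2 * t + 5, 2 * t + 8) :: (2 * t + 6, 2 * t + 7) ::
      (2 * t + 6, 2 * t + 8) :: capE t

theorem capE_length : ∀ t, (capE t).length = 4 * t + 11
  | 0 => rfl
  | t + 1 => by simp only [capE, List.length_cons, capE_length t]; ring

theorem ham_cap {r : ℕ → ℕ → Prop} (hr : Mat r) (t : ℕ) :
    ∃ q : List ℕ, q.Perm (List.range (2 * t + 5)) ∧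
      List.IsChain (Sadj (capE t) r) ((2 * t + 5) :: (q ++ [2 * t + 6])) := by
  induction t with
  | zero => exact ham7 hr
  | succ t ih =>
    obtain ⟨q, hq, hc⟩ := ih
    have hc' : List.IsChain (Sadj (capE (t + 1)) r) ((2 * t + 5) :: (q ++ [2 * t + 6])) :=
      hc.imp fun a b h => h.mono (by intro e he; simp [capE, he])
    have hrev : List.IsChain (Sadj (capE (t + 1)) r) ((2 * t + 6) :: (q.reverse ++ [2 * t + 5])) := by
      have := List.isChain_reverse.2 (hc'.imp fun a b h => (Sadj.symm hr h))
      simpa using this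
    have hperm : ((2 * t + 5) :: (q ++ [2 * t + 6])).Perm (List.range (2 * (t + 1) + 5)) := by
      have e : 2 * (t + 1) + 5 = 2 * t + 5 + 1 + 1 := by ring
      rw [e, List.range_succ, List.range_succ]
      refine List.Perm.trans ?_ (List.Perm.append_right _ (List.perm_append_comm (l₁ := [2 * t + 5])))
      simpa using hq.append_right _
    have h57 : (2 * t + 5, 2 * t + 7) ∈ capE (t + 1) := by simp [capE]
    have h58 : (2 * t + 5, 2 * t + 8) ∈ capE (t + 1) := by simp [capE]
    have h67 : (2 * t + 6, 2 * t + 7) ∈ capE (t + 1) := by simp [capE]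
    have h68 : (2 * t + 6, 2 * t + 8) ∈ capE (t + 1) := by simp [capE]
    have key : (¬ r (2 * t + 7) (2 * t + 5) ∧ ¬ r (2 * t + 6) (2 * t + 8)) ∨
        (¬ r (2 * t + 7) (2 * t + 6) ∧ ¬ r (2 * t + 5) (2 * t + 8)) := by
      by_contra hcon
      have s := hr.symm
      have u := hr.uniq
      grind
    rcases key with ⟨k1, k2⟩ | ⟨k1, k2⟩
    · refine ⟨(2 * t + 5) :: (q ++ [2 * t + 6]), hperm, ?_⟩
      have : List.IsChain (Sadj (capE (t + 1)) r)
          ((2 * t + 7) :: (((2 * t + 5) :: (q ++ [2 * t + 6])) ++ [2 * t + 8])) := by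
        rw [← List.cons_append, List.isChain_append]
        refine ⟨List.isChain_cons_cons.2 ⟨⟨Or.inr h57, k1⟩, hc'⟩, by simp, ?_⟩
        intro x hx y hy
        simp at hx hy
        have hx : x = 2 * t + 6 := by
          rw [← List.cons_append, List.getLast?_concat] at hx; exact (Option.some.inj hx).symm
        subst hx; subst hy
        exact ⟨Or.inl h68, k2⟩
      exact this
    · refine ⟨(2 * t + 6) :: (q.reverse ++ [2 * t + 5]), ?_, ?_⟩
      · refine List.Perm.trans ?_ hperm
        have := List.reverse_perm ((2 * t + 5) :: (q ++ [2 * t + 6]))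
        simpa using this
      have : List.IsChain (Sadj (capE (t + 1)) r)
          ((2 * t + 7) :: (((2 * t + 6) :: (q.reverse ++ [2 * t + 5])) ++ [2 * t + 8])) := by
        rw [← List.cons_append, List.isChain_append]
        refine ⟨List.isChain_cons_cons.2 ⟨⟨Or.inr h67, k1⟩, hrev⟩, by simp, ?_⟩
        intro x hx y hy
        simp at hx hy
        have hx : x = 2 * t + 5 := by
          rw [← List.cons_append, List.getLast?_concat] at hx; exact (Option.some.inj hx).symm
        subst hx; subst hy
        exact ⟨Or.inl h58, k2⟩
      exact this

/-- the whole graph on `2 * t + 10` vertices -/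
def fullE (t : ℕ) : List (ℕ × ℕ) :=
  capE t ++ E5.map fun e => (2 * t + 5 + e.1, 2 * t + 5 + e.2)

theorem ham_full {r : ℕ → ℕ → Prop} (hr : Mat r) (t : ℕ) :
    ∃ q : List ℕ, ((2 * t + 5) :: q).Perm (List.range (2 * t + 10)) ∧
      List.IsChain (Sadj (fullE t) r) ((2 * t + 5) :: (q ++ [2 * t + 5])) := by
  obtain ⟨q, hq, hc⟩ := ham_cap hr t
  obtain ⟨p, hp, hd⟩ := ham5 (r := fun a b => r (2 * t + 5 + a) (2 * t + 5 + b))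
    ⟨fun a b h => hr.symm _ _ h, fun a b c h h' => by have := hr.uniq _ _ _ h h'; omega⟩
  have hc' : List.IsChain (Sadj (fullE t) r) ((2 * t + 5) :: (q ++ [2 * t + 6])) :=
    hc.imp fun a b h => h.mono (by intro e he; simp [fullE, he])
  have hd' : List.IsChain (Sadj (fullE t) r)
      ((1 :: (p ++ [0])).map fun a => 2 * t + 5 + a) := by
    rw [List.isChain_map]
    refine hd.imp fun a b h => ⟨?_, h.2⟩
    have hm : ∀ a b, (a, b) ∈ E5 → (2 * t + 5 + a, 2 * t + 5 + b) ∈ fullE t := fun a b h =>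
      List.mem_append_right _ (List.mem_map.2 ⟨(a, b), h, rfl⟩)
    exact h.1.imp (hm _ _) (hm _ _)
  refine ⟨q ++ (2 * t + 6) :: p.map fun a => 2 * t + 5 + a, ?_, ?_⟩
  · have e : List.range (2 * t + 10) = List.range (2 * t + 5) ++
        ([0, 1] ++ [2, 3, 4]).map fun a => 2 * t + 5 + a := by
      rw [show 2 * t + 10 = (2 * t + 5) + 5 by ring, List.range_add]; rfl
    rw [e]
    refine List.Perm.trans (l₂ := q ++ (2 * t + 5) :: (2 * t + 6) :: p.map fun a => 2 * t + 5 + a)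
      (List.perm_middle.symm) ?_
    refine List.Perm.append hq ?_
    exact ((hp.map fun a => 2 * t + 5 + a).cons _).cons _
  · have : (2 * t + 5) :: ((q ++ (2 * t + 6) :: p.map fun a => 2 * t + 5 + a) ++ [2 * t + 5]) =
        ((2 * t + 5) :: q) ++ ((1 :: (p ++ [0])).map fun a => 2 * t + 5 + a) := by
      simp
    rw [this]
    rw [show (2 * t + 5) :: (q ++ [2 * t + 6]) = ((2 * t + 5) :: q) ++ [2 * t + 6] from rfl] at hc'
    rw [List.isChain_append] at hc' ⊢
    exact ⟨hc'.1, hd', hc'.2.2⟩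

theorem mat_of_not_contains {N : ℕ} (R : SimpleGraph (Fin N)) (h : ¬ Contains R (pathGraph 3)) :
    Mat fun a b => ∃ (ha : a < N) (hb : b < N), R.Adj ⟨a, ha⟩ ⟨b, hb⟩ := by
  refine ⟨fun a b ⟨ha, hb, h⟩ => ⟨hb, ha, h.symm⟩, ?_⟩
  rintro a b c ⟨ha, hb, hab⟩ ⟨_, hc, hac⟩
  by_contra hbc
  apply h
  refine ⟨⟨![⟨b, hb⟩, ⟨a, ha⟩, ⟨c, hc⟩], ?_⟩, ?_⟩
  · intro x y hxy
    rw [pathGraph_adj] at hxy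
    fin_cases x <;> fin_cases y <;> simp at hxy ⊢
    · exact hab.symm
    · exact hab
    · exact hac
    · exact hac.symm
  · have h1 := hab.ne
    have h2 := hac.ne
    intro x y hxy
    fin_cases x <;> fin_cases y <;> simp at hxy h1 h2 ⊢ <;> omega

/-- graph from an edge list -/
def graphOf (N : ℕ) (E : List (ℕ × ℕ)) : SimpleGraph (Fin N) :=
  SimpleGraph.fromRel fun a b => (a.1, b.1) ∈ E

theorem graphOf_card (N : ℕ) (E : List (ℕ × ℕ)) : (graphOf N E).edgeSet.ncard ≤ E.length := by
  classical
  have hinj : Function.Injective (Sym2.map (Fin.val : Fin N → ℕ)) :=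
    Sym2.map.injective Fin.val_injective
  rw [← Set.ncard_image_of_injective _ hinj]
  have : Sym2.map (Fin.val : Fin N → ℕ) '' (graphOf N E).edgeSet ⊆
      ((E.map fun e => s(e.1, e.2)).toFinset : Finset (Sym2 ℕ)) := by
    rintro _ ⟨e, he, rfl⟩
    induction e with
    | _ a b =>
      rw [mem_edgeSet, graphOf, fromRel_adj] at he
      simp only [Sym2.map_mk, List.coe_toFinset, List.mem_map, Set.mem_ofPred_eq]
      rcases he.2 with h | h
      · exact ⟨_, h, rfl⟩
      · exact ⟨_, h, Sym2.eq_swap⟩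
  calc _ ≤ _ := Set.ncard_le_ncard this (Finset.finite_toSet _)
    _ = _ := Set.ncard_coe_finset _
    _ ≤ _ := List.toFinset_card_le _
    _ = _ := by simp

theorem contains_of_cycle {N : ℕ} (hN : 3 ≤ N) (E : List (ℕ × ℕ)) (R : SimpleGraph (Fin N))
    (a : ℕ) (q : List ℕ) (hp : (a :: q).Perm (List.range N))
    (hc : List.IsChain (Sadj E fun a b => ∃ (ha : a < N) (hb : b < N), R.Adj ⟨a, ha⟩ ⟨b, hb⟩)
      (a :: (q ++ [a]))) :
    Contains (graphOf N E \ R) (cycleGraph N) := by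
  have hlen : (a :: q).length = N := by rw [hp.length_eq, List.length_range]
  have hnd : (a :: q).Nodup := hp.nodup_iff.2 List.nodup_range
  have hlt : ∀ i (hi : i < (a :: q).length), (a :: q)[i] < N := fun i hi =>
    List.mem_range.1 (hp.mem_iff.1 (List.getElem_mem hi))
  set f : Fin N → Fin N := fun i => ⟨(a :: q)[i.1]'(by rw [hlen]; exact i.2), hlt _ _⟩ with hf
  have hinj : Function.Injective f := by
    intro i j hij
    have := congrArg Fin.val hij
    exact Fin.ext ((List.Nodup.getElem_inj_iff hnd).1 this)
  have step : ∀ i j : Fin N, j.1 = (i.1 + 1) % N → (graphOf N E \ R).Adj (f i) (f j) := by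
    intro i j hij
    have hij' : i ≠ j := by
      rintro rfl
      have := i.2
      rcases Nat.lt_or_ge (i.1 + 1) N with h | h
      · rw [Nat.mod_eq_of_lt h] at hij; omega
      · have : i.1 + 1 = N := by omega
        rw [this, Nat.mod_self] at hij; omega
    have hlen2 : (a :: (q ++ [a])).length = N + 1 := by simp at hlen ⊢; omega
    have hi := i.2
    have h := (List.isChain_iff_getElem.1 hc) i.1 (by omega)
    have e1 : (a :: (q ++ [a]))[i.1]'(by omega) = (f i).1 := by
      simp only [hf, ← List.cons_append]
      rw [List.getElem_append_left]
    have e2 : (a :: (q ++ [a]))[i.1 + 1]'(by omega) = (f j).1 := by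
      simp only [hf, ← List.cons_append]
      rcases Nat.lt_or_ge (i.1 + 1) N with h | h
      · rw [Nat.mod_eq_of_lt h] at hij
        rw [List.getElem_append_left (by omega)]
        simp only [hij]
      · have h' : i.1 + 1 = N := by omega
        rw [h', Nat.mod_self] at hij
        rw [List.getElem_append_right (by omega)]
        simp [hij]
    rw [e1, e2] at h
    rw [sdiff_adj, graphOf, fromRel_adj]
    exact ⟨⟨fun h => hij' (hinj h), h.1⟩, fun hR => h.2 ⟨(f i).2, (f j).2, hR⟩⟩
  refine ⟨⟨f, ?_⟩, hinj⟩
  intro i j hij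
  obtain ⟨m, rfl⟩ : ∃ m, N = m + 2 := ⟨N - 2, by omega⟩
  rw [cycleGraph_adj] at hij
  have aux : ∀ i j : Fin (m + 2), j - i = 1 → j.1 = (i.1 + 1) % (m + 2) := by
    intro i j h
    have : j = i + 1 := by rw [← h]; abel
    rw [this, Fin.val_add]; rfl
  rcases hij with h | h
  · exact (step j i (aux _ _ h)).symm
  · exact step i j (aux _ _ h)

theorem upper (n : ℕ) (hn : 8 ≤ n) (he : Even n) :
    ∃ F : SimpleGraph (Fin n), F.edgeSet.ncard ≤ 2 * n - 1 ∧
      Arrows F (pathGraph 3) (cycleGraph n) := by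
  rcases eq_or_lt_of_le hn with rfl | h9
  · refine ⟨graphOf 8 E8, (graphOf_card _ _).trans (by decide), fun R _ => ?_⟩
    by_cases hR : Contains R (pathGraph 3)
    · exact Or.inl hR
    · obtain ⟨q, hq, hc⟩ := ham8 (mat_of_not_contains R hR)
      exact Or.inr (contains_of_cycle (by omega) _ _ _ _ hq hc)
  · obtain ⟨t, rfl⟩ : ∃ t, n = 2 * t + 10 := by
      obtain ⟨m, rfl⟩ := he
      exact ⟨m - 5, by omega⟩
    refine ⟨graphOf _ (fullE t), (graphOf_card _ _).trans ?_, fun R _ => ?_⟩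
    · simp only [fullE, List.length_append, List.length_map, capE_length]
      simp [E5]; omega
    by_cases hR : Contains R (pathGraph 3)
    · exact Or.inl hR
    · obtain ⟨q, hq, hc⟩ := ham_full (mat_of_not_contains R hR) t
      exact Or.inr (contains_of_cycle (by omega) _ _ _ _ hq hc)

end RSR

namespace RSR

/-- successor and predecessor maps of a Hamilton cycle -/
structure Ham {V : Type} (F : SimpleGraph V) (σ s p : V → V) : Prop where
  ps : ∀ v, p (s v) = v
  sp : ∀ v, s (p v) = v
  adj : ∀ v, F.Adj v (s v)
  adjp : ∀ v, F.Adj v (p v)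
  ne : ∀ v, s v ≠ p v
  nσ : ∀ v, s v ≠ σ v
  nσp : ∀ v, p v ≠ σ v
  trans : ∀ S : Set V, S.Nonempty → (∀ v ∈ S, s v ∈ S) → ∀ v, v ∈ S

theorem exists_ham {V : Type} [Fintype V] (F : SimpleGraph V) {n : ℕ} (hn : 3 ≤ n)
    (hV : Fintype.card V = n) (hF : Arrows F (pathGraph 3) (cycleGraph n))
    (σ : V → V) (h1 : ∀ v, σ (σ v) = v) (h2 : ∀ v, σ v ≠ v → F.Adj v (σ v)) :
    ∃ s p, Ham F σ s p := by
  let R : SimpleGraph V :=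
    { Adj := fun v w => v ≠ w ∧ σ v = w
      symm := ⟨fun v w h => ⟨h.1.symm, by rw [← h.2, h1]⟩⟩
      loopless := ⟨fun v h => h.1 rfl⟩ }
  have hR : R ≤ F := by
    rintro v w ⟨h, rfl⟩
    exact h2 v h.symm
  rcases hF R hR with ⟨f, hf⟩ | ⟨f, hf⟩
  · exfalso
    have a1 : R.Adj (f 1) (f 0) := f.map_rel (by simp [pathGraph_adj])
    have a2 : R.Adj (f 1) (f 2) := f.map_rel (by simp [pathGraph_adj])
    have : f 0 = f 2 := a1.2.symm.trans a2.2
    exact absurd (hf this) (by decide)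
  · obtain ⟨m, rfl⟩ : ∃ m, n = m + 3 := ⟨n - 3, by omega⟩
    have hb : Function.Bijective f :=
      (Fintype.bijective_iff_injective_and_card f).2 ⟨hf, by simp [hV]⟩
    let e : Fin (m + 3) ≃ V := Equiv.ofBijective f hb
    have hadj : ∀ i, (F \ R).Adj (e i) (e (i + 1)) := fun i =>
      f.map_rel (by rw [cycleGraph_adj]; right; abel)
    have hadj2 : ∀ v, (F \ R).Adj v (e (e.symm v + 1)) := fun v => by
      simpa using hadj (e.symm v)
    have hadj3 : ∀ v, (F \ R).Adj v (e (e.symm v - 1)) := fun v => by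
      simpa using (hadj (e.symm v - 1)).symm
    refine ⟨fun v => e (e.symm v + 1), fun v => e (e.symm v - 1),
      ⟨by simp, by simp, fun v => (hadj2 v).1, fun v => (hadj3 v).1, ?_, ?_, ?_, ?_⟩⟩
    · intro v h
      have h := e.injective h
      have h3 : (1 : Fin (m + 3)) + 1 = 0 := by
        have : e.symm v + 1 - (e.symm v - 1) = 0 := by rw [h, sub_self]
        rw [← this]; abel
      have := congrArg Fin.val h3
      rw [Fin.val_add] at this
      simp [Nat.mod_eq_of_lt (show 2 < m + 3 by omega)] at this
    · intro v h
      exact (hadj2 v).2 ⟨(hadj2 v).ne, h.symm⟩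
    · intro v h
      exact (hadj3 v).2 ⟨(hadj3 v).ne, h.symm⟩
    · rintro S ⟨v0, hv0⟩ hS v
      have key : ∀ k : Fin (m + 3), e (e.symm v0 + k) ∈ S := by
        intro k
        induction k using Fin.induction with
        | zero => simpa using hv0
        | succ k ih =>
          have := hS _ ih
          rw [← Fin.coeSucc_eq_succ]
          simpa [add_assoc] using this
      have := key (e.symm v - e.symm v0)
      simpa using this

/-- `a` is a cubic vertex with neighbours `u, x, y` -/
def Cub {V : Type} (F : SimpleGraph V) (a u x y : V) : Prop :=
  (∀ z, F.Adj a z ↔ z = u ∨ z = x ∨ z = y) ∧ u ≠ x ∧ u ≠ y ∧ x ≠ y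

theorem Cub.swap {V : Type} {F : SimpleGraph V} {a u x y : V} (h : Cub F a u x y) :
    Cub F a u y x := ⟨fun z => by rw [h.1]; tauto, h.2.2.1, h.2.1, h.2.2.2.symm⟩

theorem force {V : Type} {F : SimpleGraph V} {σ s p : V → V} (H : Ham F σ s p)
    {a u x y : V} (h : Cub F a u x y) (hx : σ a = x) : a = s u ∨ a = p u := by
  have h1 := (h.1 _).1 (H.adj a)
  have h2 := (h.1 _).1 (H.adjp a)
  have h3 := H.ne a
  have h4 := H.nσ a
  have h5 := H.nσp a
  have h6 := H.ps a
  have h7 := H.sp a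
  grind

theorem not_small {V : Type} [Fintype V] {n : ℕ} (hn : 8 ≤ n)
    (hV : Fintype.card V = n) (S : Finset V) (hS : S.card < 8) : ∃ v, v ∉ S := by
  by_contra h
  push Not at h
  have : S = Finset.univ := Finset.eq_univ_iff_forall.2 h
  rw [this, Finset.card_univ] at hS
  omega

theorem no_sigma {V : Type} [Fintype V] (F : SimpleGraph V) {n : ℕ} (hn : 8 ≤ n)
    (hV : Fintype.card V = n) (hF : Arrows F (pathGraph 3) (cycleGraph n)) {u a b c x y x' y' x'' y'' : V} (ha : Cub F a u x y)
    (hb : Cub F b u x' y') (hc : Cub F c u x'' y'')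
    (hab : a ≠ b) (hac : a ≠ c) (hbc : b ≠ c)
    (σ : V → V) (h1 : ∀ v, σ (σ v) = v) (h2 : ∀ v, σ v ≠ v → F.Adj v (σ v))
    (hx : σ a = x) (hx' : σ b = x') (hx'' : σ c = x'') : False := by
  obtain ⟨s, p, H⟩ := exists_ham F (by omega) hV hF σ h1 h2
  have k1 := force H ha hx
  have k2 := force H hb hx'
  have k3 := force H hc hx''
  grind

theorem no_sdr {V : Type} [Fintype V] (F : SimpleGraph V) {n : ℕ} (hn : 8 ≤ n)
    (hV : Fintype.card V = n) (hF : Arrows F (pathGraph 3) (cycleGraph n)) {u a b c x y x' y' x'' y'' : V} (ha : Cub F a u x y)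
    (hb : Cub F b u x' y') (hc : Cub F c u x'' y'')
    (hab : a ≠ b) (hac : a ≠ c) (hbc : b ≠ c)
    (nab : ¬ F.Adj a b) (nac : ¬ F.Adj a c) (nbc : ¬ F.Adj b c)
    (d1 : x ≠ x') (d2 : x ≠ x'') (d3 : x' ≠ x'') : False := by
  classical
  have e1 : F.Adj a x := (ha.1 x).2 (by simp)
  have e2 : F.Adj b x' := (hb.1 x').2 (by simp)
  have e3 : F.Adj c x'' := (hc.1 x'').2 (by simp)
  have f1 := e1.ne
  have f2 := e2.ne
  have f3 := e3.ne
  have g1 := e1.symm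
  have g2 := e2.symm
  have g3 := e3.symm
  have t1 : x ≠ b := by rintro rfl; exact nab e1
  have t2 : x ≠ c := by rintro rfl; exact nac e1
  have t3 : x' ≠ a := by rintro rfl; exact nab e2.symm
  have t4 : x' ≠ c := by rintro rfl; exact nbc e2
  have t5 : x'' ≠ a := by rintro rfl; exact nac e3.symm
  have t6 : x'' ≠ b := by rintro rfl; exact nbc e3.symm
  refine no_sigma F hn hV hF ha hb hc hab hac hbc
    (fun v => if v = a then x else if v = x then a else if v = b then x' else if v = x' then b
      else if v = c then x'' else if v = x'' then c else v) ?_ ?_ ?_ ?_ ?_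
  · intro v; grind
  · intro v hv; grind
  · grind
  · grind
  · grind

theorem no_edge {V : Type} [Fintype V] (F : SimpleGraph V) {n : ℕ} (hn : 8 ≤ n)
    (hV : Fintype.card V = n) (hF : Arrows F (pathGraph 3) (cycleGraph n)) {u a b c y y' x'' y'' : V} (ha : Cub F a u b y)
    (hb : Cub F b u a y') (hc : Cub F c u x'' y'')
    (hab : a ≠ b) (hac : a ≠ c) (hbc : b ≠ c)
    (d1 : x'' ≠ a) (d2 : x'' ≠ b) : False := by
  classical
  have e1 : F.Adj a b := (ha.1 b).2 (by simp)
  have e3 : F.Adj c x'' := (hc.1 x'').2 (by simp)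
  have f3 := e3.ne
  have g1 := e1.symm
  have g3 := e3.symm
  refine no_sigma F hn hV hF ha hb hc hab hac hbc
    (fun v => if v = a then b else if v = b then a
      else if v = c then x'' else if v = x'' then c else v) ?_ ?_ ?_ ?_ ?_
  · intro v; grind
  · intro v hv; grind
  · grind
  · grind
  · grind

theorem no_K4 {V : Type} [Fintype V] (F : SimpleGraph V) {n : ℕ} (hn : 8 ≤ n)
    (hV : Fintype.card V = n) (hF : Arrows F (pathGraph 3) (cycleGraph n)) {u a b c : V} (ha : Cub F a u b c) (hb : Cub F b u a c) (hc : Cub F c u a b) :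
    False := by
  classical
  have hab : F.Adj a b := (ha.1 b).2 (by simp)
  have hab' := hab.symm
  obtain ⟨s, p, H⟩ := exists_ham F (by omega) hV hF
    (fun v => if v = a then b else if v = b then a else v) (by intro v; grind) (by intro v; grind)
  have k1 := force H ha (by simp)
  have k2 := force H hb (by simp [hab'.ne])
  have hba : a ≠ b := hab.ne
  have hcne : a ≠ c ∧ b ≠ c := ⟨((ha.1 c).2 (by simp)).ne, ((hb.1 c).2 (by simp)).ne⟩
  have ha1 := (ha.1 _).1 (H.adj a)
  have ha2 := (ha.1 _).1 (H.adjp a)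
  have hb1 := (hb.1 _).1 (H.adj b)
  have hb2 := (hb.1 _).1 (H.adjp b)
  have na1 := H.nσ a
  have na2 := H.nσp a
  have nb1 := H.nσ b
  have nb2 := H.nσp b
  have n1 := H.ne a
  have n2 := H.ne b
  have n3 := H.ne u
  have n4 := H.ne c
  have i1 := H.ps
  have i2 := H.sp
  obtain ⟨v, hv⟩ := not_small hn hV {u, a, b, c} (by
    refine lt_of_le_of_lt Finset.card_le_four (by norm_num))
  apply hv
  have := H.trans (↑({u, a, b, c} : Finset V)) ⟨u, by simp⟩ (by
    intro w hw
    simp only [Finset.coe_insert, Finset.coe_singleton, Set.mem_insert_iff,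
      Set.mem_singleton_iff] at hw ⊢
    simp only [if_true] at na1 na2
    simp only [hba.symm, if_true, if_false] at nb1 nb2
    rcases hw with rfl | rfl | rfl | rfl
    · grind
    · grind
    · grind
    · grind) v
  exact_mod_cast this

theorem no_K33 {V : Type} [Fintype V] (F : SimpleGraph V) {n : ℕ} (hn : 8 ≤ n)
    (hV : Fintype.card V = n) (hF : Arrows F (pathGraph 3) (cycleGraph n)) {u a b c x y : V} (ha : Cub F a u x y) (hb : Cub F b u x y) (hc : Cub F c u x y)
    (hab : a ≠ b) (hac : a ≠ c) (hbc : b ≠ c) : False := by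
  classical
  obtain ⟨s, p, H⟩ := exists_ham F (by omega) hV hF id (by simp) (by simp)
  have ha1 := (ha.1 _).1 (H.adj a)
  have ha2 := (ha.1 _).1 (H.adjp a)
  have hb1 := (hb.1 _).1 (H.adj b)
  have hb2 := (hb.1 _).1 (H.adjp b)
  have hc1 := (hc.1 _).1 (H.adj c)
  have hc2 := (hc.1 _).1 (H.adjp c)
  have sinj : Function.Injective s := Function.LeftInverse.injective H.ps
  have pinj : Function.Injective p := Function.LeftInverse.injective H.sp
  obtain ⟨v, hv⟩ := not_small hn hV {u, x, y, a, b, c} (by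
    refine lt_of_le_of_lt Finset.card_le_six (by norm_num))
  apply hv
  have q1 := pinj.ne hab
  have q2 := pinj.ne hac
  have q3 := pinj.ne hbc
  have i2 := H.sp
  have := H.trans (↑({u, x, y, a, b, c} : Finset V)) ⟨u, by simp⟩ (by
    intro w hw
    simp only [Finset.coe_insert, Finset.coe_singleton, Set.mem_insert_iff,
      Set.mem_singleton_iff] at hw ⊢
    have hT : ∀ w, w = u ∨ w = x ∨ w = y → w = p a ∨ w = p b ∨ w = p c := by
      have hsub : ({p a, p b, p c} : Finset V) ⊆ {u, x, y} := by
        intro z hz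
        simp only [Finset.mem_insert, Finset.mem_singleton] at hz ⊢
        rcases hz with rfl | rfl | rfl
        · exact ha2
        · exact hb2
        · exact hc2
      have hcard : ({p a, p b, p c} : Finset V).card = 3 :=
        Finset.card_eq_three.2 ⟨_, _, _, q1, q2, q3, rfl⟩
      have heq := Finset.eq_of_subset_of_card_le hsub (by
        rw [hcard]; exact Finset.card_le_three)
      intro w hw
      have : w ∈ ({u, x, y} : Finset V) := by simpa using hw
      rw [← heq] at this
      simpa using this
    have hT' : ∀ w, w = u ∨ w = x ∨ w = y → s w = a ∨ s w = b ∨ s w = c := by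
      intro w hw
      rcases hT w hw with rfl | rfl | rfl
      · left; exact i2 a
      · right; left; exact i2 b
      · right; right; exact i2 c
    rcases hw with h | h | h | h | h | h
    · rcases hT' w (by simp [h]) with h | h | h <;> simp [h]
    · rcases hT' w (by simp [h]) with h | h | h <;> simp [h]
    · rcases hT' w (by simp [h]) with h | h | h <;> simp [h]
    · rw [h]; rcases ha1 with h | h | h <;> simp [h]
    · rw [h]; rcases hb1 with h | h | h <;> simp [h]
    · rw [h]; rcases hc1 with h | h | h <;> simp [h]) v
  exact_mod_cast this

/-- if two of the three neighbours are adjacent -/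
theorem no_three_adj {V : Type} [Fintype V] (F : SimpleGraph V) {n : ℕ} (hn : 8 ≤ n)
    (hV : Fintype.card V = n) (hF : Arrows F (pathGraph 3) (cycleGraph n)) {u a b c x y x' y' x'' y'' : V} (ha : Cub F a u x y)
    (hb : Cub F b u x' y') (hc : Cub F c u x'' y'')
    (hab : a ≠ b) (hac : a ≠ c) (hbc : b ≠ c) (h : F.Adj a b) : False := by
  have ub : u ≠ b := by
    rintro rfl; exact F.irrefl ((hb.1 u).2 (by simp))
  have ua : u ≠ a := by
    rintro rfl; exact F.irrefl ((ha.1 u).2 (by simp))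
  obtain ⟨y1, ha'⟩ : ∃ y1, Cub F a u b y1 := by
    rcases (ha.1 b).1 h with h | rfl | rfl
    · exact absurd h.symm ub
    · exact ⟨_, ha⟩
    · exact ⟨_, ha.swap⟩
  obtain ⟨y2, hb'⟩ : ∃ y2, Cub F b u a y2 := by
    rcases (hb.1 a).1 h.symm with h | rfl | rfl
    · exact absurd h.symm ua
    · exact ⟨_, hb⟩
    · exact ⟨_, hb.swap⟩
  have k1 : x'' = a ∨ x'' = b := by
    by_contra hcon
    push Not at hcon
    exact no_edge F hn hV hF ha' hb' hc hab hac hbc hcon.1 hcon.2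
  have k2 : y'' = a ∨ y'' = b := by
    by_contra hcon
    push Not at hcon
    exact no_edge F hn hV hF ha' hb' hc.swap hab hac hbc hcon.1 hcon.2
  have hc' : Cub F c u a b := by
    have := hc.2.2.2
    rcases k1 with rfl | rfl <;> rcases k2 with rfl | rfl
    · exact absurd rfl this
    · exact hc
    · exact hc.swap
    · exact absurd rfl this
  have hac' : F.Adj a c := ((hc'.1 a).2 (by simp)).symm
  have hbc' : F.Adj b c := ((hc'.1 b).2 (by simp)).symm
  have uc : u ≠ c := by
    rintro rfl; exact F.irrefl ((hc.1 u).2 (by simp))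
  have e1 : y1 = c := by
    rcases (ha'.1 c).1 hac' with h | h | h
    · exact absurd h.symm uc
    · exact absurd h.symm hbc
    · exact h.symm
  have e2 : y2 = c := by
    rcases (hb'.1 c).1 hbc' with h | h | h
    · exact absurd h.symm uc
    · exact absurd h.symm hac
    · exact h.symm
  subst e1
  subst e2
  exact no_K4 F hn hV hF ha' hb' hc'

theorem no_three {V : Type} [Fintype V] (F : SimpleGraph V) {n : ℕ} (hn : 8 ≤ n)
    (hV : Fintype.card V = n) (hF : Arrows F (pathGraph 3) (cycleGraph n)) {u a b c x y x' y' x'' y'' : V} (ha : Cub F a u x y)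
    (hb : Cub F b u x' y') (hc : Cub F c u x'' y'')
    (hab : a ≠ b) (hac : a ≠ c) (hbc : b ≠ c) : False := by
  by_cases nab : F.Adj a b
  · exact no_three_adj F hn hV hF ha hb hc hab hac hbc nab
  by_cases nac : F.Adj a c
  · exact no_three_adj F hn hV hF ha hc hb hac hab hbc.symm nac
  by_cases nbc : F.Adj b c
  · exact no_three_adj F hn hV hF hb hc ha hbc hab.symm hac.symm nbc
  have key : ∀ {x y x' y' x'' y''}, Cub F a u x y → Cub F b u x' y' → Cub F c u x'' y'' →
      x = x' ∨ x = x'' ∨ x' = x'' := fun ha hb hc => by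
    by_contra hcon
    push Not at hcon
    exact no_sdr F hn hV hF ha hb hc hab hac hbc nab nac nbc hcon.1 hcon.2.1 hcon.2.2
  have r1 := key ha hb hc
  have r2 := key ha hb hc.swap
  have r3 := key ha hb.swap hc
  have r4 := key ha hb.swap hc.swap
  have r5 := key ha.swap hb hc
  have r6 := key ha.swap hb hc.swap
  have r7 := key ha.swap hb.swap hc
  have r8 := key ha.swap hb.swap hc.swap
  have n1 := ha.2.2.2
  have n2 := hb.2.2.2
  have n3 := hc.2.2.2
  have m1 : (x = x' ∧ y = y') ∨ (x = y' ∧ y = x') := by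
    clear key ha hb hc hF; grind
  have m2 : (x = x'' ∧ y = y'') ∨ (x = y'' ∧ y = x'') := by
    clear key ha hb hc hF; grind
  have hb' : Cub F b u x y := by
    rcases m1 with ⟨rfl, rfl⟩ | ⟨rfl, rfl⟩
    · exact hb
    · exact hb.swap
  have hc' : Cub F c u x y := by
    rcases m2 with ⟨rfl, rfl⟩ | ⟨rfl, rfl⟩
    · exact hc
    · exact hc.swap
  exact no_K33 F hn hV hF ha hb' hc' hab hac hbc

open Classical in
theorem deg_ge {V : Type} [Fintype V] (F : SimpleGraph V) {n : ℕ} (hn : 8 ≤ n)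
    (hV : Fintype.card V = n) (hF : Arrows F (pathGraph 3) (cycleGraph n)) (v : V) : 3 ≤ F.degree v := by
  obtain ⟨s, p, H⟩ := exists_ham F (by omega) hV hF id (by simp) (by simp)
  have hadj := H.adj v
  have hadj' := hadj.symm
  have hne := hadj.ne
  obtain ⟨s', p', H'⟩ := exists_ham F (by omega) hV hF
    (fun w => if w = v then s v else if w = s v then v else w)
    (by intro w; grind) (by intro w; grind)
  have h1 := H'.nσ v
  have h2 := H'.nσp v
  simp only [if_true] at h1 h2
  have : ({s v, s' v, p' v} : Finset V) ⊆ F.neighborFinset v := by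
    intro w hw
    simp only [Finset.mem_insert, Finset.mem_singleton] at hw
    rw [mem_neighborFinset]
    rcases hw with rfl | rfl | rfl
    · exact hadj
    · exact H'.adj v
    · exact H'.adjp v
  calc 3 = ({s v, s' v, p' v} : Finset V).card :=
        (Finset.card_eq_three.2 ⟨_, _, _, h1.symm, h2.symm, H'.ne v, rfl⟩).symm
    _ ≤ _ := Finset.card_le_card this

open Classical in
theorem cub_of_degree {V : Type} [Fintype V] (F : SimpleGraph V) {a u : V} (h : F.degree a = 3) (hu : F.Adj a u) :
    ∃ x y, Cub F a u x y := by
  have h1 : u ∈ F.neighborFinset a := by simpa using hu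
  have h2 : ((F.neighborFinset a).erase u).card = 2 := by
    rw [Finset.card_erase_of_mem h1, card_neighborFinset_eq_degree, h]
  obtain ⟨x, y, hxy, he⟩ := Finset.card_eq_two.1 h2
  have hx : x ∈ (F.neighborFinset a).erase u := by rw [he]; simp
  have hy : y ∈ (F.neighborFinset a).erase u := by rw [he]; simp
  refine ⟨x, y, fun z => ?_, (Finset.ne_of_mem_erase hx).symm, (Finset.ne_of_mem_erase hy).symm,
    hxy⟩
  have hz : z ∈ insert u ((F.neighborFinset a).erase u) ↔ F.Adj a z := by
    rw [Finset.insert_erase h1, mem_neighborFinset]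
  rw [← hz, he]
  simp

open Classical in
theorem lower {V : Type} [Fintype V] (F : SimpleGraph V) {n : ℕ} (hn : 8 ≤ n)
    (hV : Fintype.card V = n) (hF : Arrows F (pathGraph 3) (cycleGraph n)) : 3 * n / 2 + 2 ≤ F.edgeSet.ncard := by
  by_contra hlt
  push Not at hlt
  have hE : F.edgeSet.ncard = F.edgeFinset.card := by
    rw [← coe_edgeFinset, Set.ncard_coe_finset]
  have hsum := F.sum_degrees_eq_twice_card_edges
  have hge := deg_ge F hn hV hF
  set B := Finset.univ.filter fun v => F.degree v ≠ 3 with hB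
  have hBc : B.card ≤ 2 := by
    have h1 : ∑ v, (3 + if F.degree v ≠ 3 then 1 else 0) ≤ ∑ v, F.degree v := by
      refine Finset.sum_le_sum fun v _ => ?_
      have := hge v
      split_ifs <;> omega
    rw [Finset.sum_add_distrib, ← Finset.card_filter] at h1
    simp only [Finset.sum_const, Finset.card_univ, hV, smul_eq_mul] at h1
    have h2 : (Finset.univ.filter fun v => F.degree v ≠ 3).card = B.card := by
      rw [hB]
    have h3 : 3 * n + B.card ≤ ∑ v, F.degree v := by
      rw [← h2, mul_comm]; convert h1
    omega
  obtain ⟨u, hu⟩ : ∃ u, 3 ≤ (F.neighborFinset u \ B).card := by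
    rcases B.eq_empty_or_nonempty with h | ⟨u, hu⟩
    · have : 0 < Fintype.card V := by omega
      obtain ⟨u⟩ := Fintype.card_pos_iff.1 this
      refine ⟨u, ?_⟩
      rw [h, Finset.sdiff_empty, card_neighborFinset_eq_degree]
      exact hge u
    · refine ⟨u, ?_⟩
      have hu4 : F.degree u ≠ 3 := (Finset.mem_filter.1 hu).2
      have := hge u
      have h1 : F.neighborFinset u \ B = F.neighborFinset u \ (B.erase u) := by
        ext w
        simp only [Finset.mem_sdiff, mem_neighborFinset, Finset.mem_erase]
        constructor
        · rintro ⟨h, h'⟩; exact ⟨h, fun h'' => h' h''.2⟩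
        · rintro ⟨h, h'⟩; exact ⟨h, fun h'' => h' ⟨h.ne', h''⟩⟩
      rw [h1]
      have h2 := Finset.le_card_sdiff (B.erase u) (F.neighborFinset u)
      rw [card_neighborFinset_eq_degree, Finset.card_erase_of_mem hu] at h2
      omega
  obtain ⟨a, b, c, ha, hb, hc, hab, hac, hbc⟩ := Finset.two_lt_card_iff.1 hu
  have hd : ∀ a, a ∈ F.neighborFinset u \ B → ∃ x y, Cub F a u x y := by
    intro a ha
    simp only [hB, Finset.mem_sdiff, mem_neighborFinset, Finset.mem_filter, Finset.mem_univ,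
      true_and, not_not] at ha
    exact cub_of_degree F ha.2 ha.1.symm
  obtain ⟨_, _, ha⟩ := hd a ha
  obtain ⟨_, _, hb⟩ := hd b hb
  obtain ⟨_, _, hc⟩ := hd c hc
  exact no_three F hn hV hF ha hb hc hab hac hbc

end RSR

theorem stmt_18 (n : ℕ) (hn : 8 ≤ n) (he : Even n) :
    (∀ (V : Type) [Fintype V] (F : SimpleGraph V), Fintype.card V = n →
      Arrows F (pathGraph 3) (cycleGraph n) → 3 * n / 2 + 2 ≤ F.edgeSet.ncard) ∧
    (∃ F : SimpleGraph (Fin n), F.edgeSet.ncard ≤ 2 * n - 1 ∧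
      Arrows F (pathGraph 3) (cycleGraph n)) := by
  refine ⟨fun V _ F hV hF => RSR.lower F hn hV hF, RSR.upper n hn he⟩
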